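/- A nonnegative matrix M with rank(M) ≥ 2 is a slack matrix of a polyhedral cone if and only if the 0/1-matrix inc(M) (with (inc(M))_{ij} = 1 iff M_{ij} = 0) is an incidence matrix of some pointed polyhedral cone of dimension rank(M). -/

import Mathlib

open Matrix Set

/-- The cone generated by the rows of the matrix `A`, i.e. the set of all
nonnegative linear combinations of the rows of `A`. -/
def coneOfRows {p n : ℕ} (A : Matrix (Fin p) (Fin n) ℝ) : Set (Fin n → ℝ) :=
  {x | ∃ y : Fin p → ℝ, 0 ≤ y ∧ x = Matrix.vecMul y A}

/-- `M` is the slack matrix of the polyhedral cone `K` with respect to the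
representation `(A, B)`: `K = {x | xᵀB ≥ 0} = cone(rows A)` and `M = A * B`. -/
def IsSlackMatrixOfConeRep {p q n : ℕ} (M : Matrix (Fin p) (Fin q) ℝ)
    (K : Set (Fin n → ℝ)) (A : Matrix (Fin p) (Fin n) ℝ)
    (B : Matrix (Fin n) (Fin q) ℝ) : Prop :=
  K = {x | 0 ≤ Matrix.vecMul x B} ∧ K = coneOfRows A ∧ M = A * B

/-- `M` is a slack matrix of some polyhedral cone. -/
def IsSlackMatrixOfCone {p q : ℕ} (M : Matrix (Fin p) (Fin q) ℝ) : Prop :=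
  ∃ (n : ℕ) (A : Matrix (Fin p) (Fin n) ℝ) (B : Matrix (Fin n) (Fin q) ℝ),
    {x : Fin n → ℝ | 0 ≤ Matrix.vecMul x B} = coneOfRows A ∧ M = A * B

/-- The row cone generating condition: the cone generated by the rows of `M`
equals the intersection of the row span of `M` with the nonnegative orthant. -/
def RCGC {p q : ℕ} (M : Matrix (Fin p) (Fin q) ℝ) : Prop :=
  {z : Fin q → ℝ | ∃ y : Fin p → ℝ, 0 ≤ y ∧ z = Matrix.vecMul y M} =
    {z : Fin q → ℝ | (∃ y : Fin p → ℝ, z = Matrix.vecMul y M) ∧ 0 ≤ z}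

/-- The column cone generating condition: the cone generated by the columns of `M`
equals the intersection of the column span of `M` with the nonnegative orthant. -/
def CCGC {p q : ℕ} (M : Matrix (Fin p) (Fin q) ℝ) : Prop :=
  {z : Fin p → ℝ | ∃ c : Fin q → ℝ, 0 ≤ c ∧ z = M.mulVec c} =
    {z : Fin p → ℝ | (∃ c : Fin q → ℝ, z = M.mulVec c) ∧ 0 ≤ z}

/-- The convex hull of the rows of `V`. -/
def rowsConv {p n : ℕ} (V : Matrix (Fin p) (Fin n) ℝ) : Set (Fin n → ℝ) :=
  convexHull ℝ (Set.range fun i => V i)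

/-- `S` is a slack matrix of the polytope `P ⊆ ℝⁿ` (of dimension at least one):
there are `V`, `W`, `w` with `P = conv(rows V) = {x | Wx ≤ w}` and
`S i j = w j - ⟨row j of W, row i of V⟩`. -/
def IsSlackMatrixOfPolytopeOn {p q n : ℕ} (S : Matrix (Fin p) (Fin q) ℝ)
    (P : Set (Fin n → ℝ)) : Prop :=
  ∃ (V : Matrix (Fin p) (Fin n) ℝ) (W : Matrix (Fin q) (Fin n) ℝ) (w : Fin q → ℝ),
    P = rowsConv V ∧ P = {x | W.mulVec x ≤ w} ∧
    (∃ u ∈ P, ∃ v ∈ P, u ≠ v) ∧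
    (∀ i j, S i j = w j - ∑ k, W j k * V i k)

/-- `S` is a slack matrix of some polytope (of dimension at least one). -/
def IsSlackMatrixOfPolytope {p q : ℕ} (S : Matrix (Fin p) (Fin q) ℝ) : Prop :=
  ∃ (n : ℕ) (P : Set (Fin n → ℝ)), IsSlackMatrixOfPolytopeOn S P

/-- A cone is pointed if its lineality space is trivial, i.e. it contains no
nonzero `x` together with `-x`. -/
def IsPointedCone {n : ℕ} (K : Set (Fin n → ℝ)) : Prop :=
  ∀ x ∈ K, -x ∈ K → x = 0

/-- The dimension of a cone: the dimension of its linear hull. -/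
noncomputable def coneDim {n : ℕ} (K : Set (Fin n → ℝ)) : ℕ :=
  Module.finrank ℝ (Submodule.span ℝ K)

/-- The (affine) dimension of a set: the dimension of its affine hull. -/
noncomputable def affDim {n : ℕ} (P : Set (Fin n → ℝ)) : ℕ :=
  Module.finrank ℝ (affineSpan ℝ P).direction

/-- The 0/1 incidence pattern of a matrix: `(inc M) i j = 1` iff `M i j = 0`. -/
noncomputable def inc {p q : ℕ} (M : Matrix (Fin p) (Fin q) ℝ) : Matrix (Fin p) (Fin q) ℝ :=
  Matrix.of fun i j => if M i j = 0 then 1 else 0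

/-- `M'` is obtained from `M` by adding zero rows (keeping the order of the
original rows). -/
def AddZeroRows {p p' q : ℕ} (M : Matrix (Fin p) (Fin q) ℝ)
    (M' : Matrix (Fin p') (Fin q) ℝ) : Prop :=
  ∃ φ : Fin p → Fin p', StrictMono φ ∧ (∀ i, M' (φ i) = M i) ∧
    ∀ i', i' ∉ Set.range φ → M' i' = 0

/-- The polar of a set `P`. -/
def polarSet {n : ℕ} (P : Set (Fin n → ℝ)) : Set (Fin n → ℝ) :=
  {y | ∀ x ∈ P, ∑ i, x i * y i ≤ 1}

/-- The span of the vectors `S i`, `i ∈ I`, meets the orthant `{z | ∀ k ∈ J, 0 ≤ z k}` only in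
nonnegative combinations of these vectors. -/
def RowConeGenerating {ι κ : Type*} (S : ι → κ → ℝ) (I : Finset ι) (J : Finset κ) : Prop :=
  ∀ z ∈ Submodule.span ℝ (S '' (I : Set ι)), (∀ k ∈ J, 0 ≤ z k) →
    ∃ y : ι → ℝ, 0 ≤ y ∧ z = ∑ i ∈ I, y i • S i

section RowConeGenerating

variable {ι κ : Type*} {S M : ι → κ → ℝ} {I : Finset ι} {J : Finset κ}

theorem sum_smul_mem_span_image (S : ι → κ → ℝ) (I : Finset ι) (y : ι → ℝ) :
    ∑ i ∈ I, y i • S i ∈ Submodule.span ℝ (S '' (I : Set ι)) :=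
  Submodule.sum_mem _ fun i hi =>
    Submodule.smul_mem _ _ (Submodule.subset_span ⟨i, hi, rfl⟩)

theorem mem_span_image_filter_apply_eq_zero {j : κ} {z : κ → ℝ}
    (hz : z ∈ Submodule.span ℝ (S '' (I.filter (fun i => S i j = 0) : Set ι))) : z j = 0 := by
  have h : Submodule.span ℝ (S '' (I.filter (fun i => S i j = 0) : Set ι)) ≤
      LinearMap.ker (LinearMap.proj (R := ℝ) (φ := fun _ : κ => ℝ) j) := by
    rw [Submodule.span_le]
    rintro _ ⟨i, hi, rfl⟩
    simpa using (Finset.mem_filter.mp (Finset.mem_coe.mp hi)).2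
  simpa using h hz

/-- A nonnegative combination that vanishes at `j` only uses vectors that vanish at `j`. -/
theorem sum_eq_sum_filter_of_apply_eq_zero (hS : ∀ i k, 0 ≤ S i k) {j : κ} {y : ι → ℝ}
    (hy : 0 ≤ y) (h0 : (∑ i ∈ I, y i • S i) j = 0) :
    ∑ i ∈ I, y i • S i = ∑ i ∈ I.filter (fun i => S i j = 0), y i • S i := by
  simp only [Finset.sum_apply, Pi.smul_apply, smul_eq_mul] at h0
  rw [Finset.sum_eq_zero_iff_of_nonneg fun i _ => mul_nonneg (hy i) (hS i j)] at h0
  refine (Finset.sum_subset (Finset.filter_subset _ _) fun i hi hi' => ?_).symm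
  have hne : S i j ≠ 0 := fun h => hi' (Finset.mem_filter.mpr ⟨hi, h⟩)
  rw [(mul_eq_zero.mp (h0 i hi)).resolve_right hne, zero_smul]

theorem RowConeGenerating.filter (hS : ∀ i k, 0 ≤ S i k) (h : RowConeGenerating S I J) (j : κ) :
    RowConeGenerating S (I.filter fun i => S i j = 0) J := by
  intro z hz hzJ
  obtain ⟨y, hy, rfl⟩ := h z (Submodule.span_mono
    (Set.image_mono (Finset.coe_subset.mpr (Finset.filter_subset _ _))) hz) hzJ
  exact ⟨y, hy, sum_eq_sum_filter_of_apply_eq_zero hS hy (mem_span_image_filter_apply_eq_zero hz)⟩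

/-- An irredundant inequality defines a facet: its hyperplane section of the span is spanned by
the vectors lying in it. -/
theorem RowConeGenerating.mem_span_filter [DecidableEq κ] (hS : ∀ i k, 0 ≤ S i k)
    (h : RowConeGenerating S I J) (hcol : ∀ k ∈ J, ∃ i ∈ I, S i k ≠ 0)
    {j : κ} {x : κ → ℝ} (hx : x ∈ Submodule.span ℝ (S '' (I : Set ι)))
    (hxk : ∀ k ∈ J.erase j, 0 ≤ x k) (hxj : x j < 0)
    {v : κ → ℝ} (hv : v ∈ Submodule.span ℝ (S '' (I : Set ι))) (hvj : v j = 0) :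
    v ∈ Submodule.span ℝ (S '' (I.filter (fun i => S i j = 0) : Set ι)) := by
  have hface : ∀ z ∈ Submodule.span ℝ (S '' (I : Set ι)), z j = 0 → (∀ k ∈ J, 0 ≤ z k) →
      z ∈ Submodule.span ℝ (S '' (I.filter (fun i => S i j = 0) : Set ι)) := by
    intro z hz hzj hzJ
    obtain ⟨y, hy, rfl⟩ := h z hz hzJ
    rw [sum_eq_sum_filter_of_apply_eq_zero hS hy hzj]
    exact sum_smul_mem_span_image _ _ _
  set u : κ → ℝ := ∑ i ∈ I, S i with hu
  have hus : u ∈ Submodule.span ℝ (S '' (I : Set ι)) := by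
    simpa using sum_smul_mem_span_image S I 1
  have hu0 : ∀ k, 0 ≤ u k := fun k => by
    simpa [hu] using Finset.sum_nonneg fun i (_ : i ∈ I) => hS i k
  have hupos : ∀ k ∈ J, 0 < u k := by
    intro k hk
    obtain ⟨i, hi, hik⟩ := hcol k hk
    simpa [hu] using Finset.sum_pos' (fun i (_ : i ∈ I) => hS i k)
      ⟨i, hi, lt_of_le_of_ne (hS i k) hik.symm⟩
  set w : κ → ℝ := u j • x + (-x j) • u with hw
  have hws : w ∈ Submodule.span ℝ (S '' (I : Set ι)) :=
    Submodule.add_mem _ (Submodule.smul_mem _ _ hx) (Submodule.smul_mem _ _ hus)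
  have hwj : w j = 0 := by simp [hw]; ring
  have hwpos : ∀ k ∈ J.erase j, 0 < w k := by
    intro k hk
    have h1 : 0 ≤ u j * x k := mul_nonneg (hu0 j) (hxk k hk)
    have h2 : 0 < -x j * u k := mul_pos (by linarith) (hupos k (Finset.mem_of_mem_erase hk))
    simp only [hw, Pi.add_apply, Pi.smul_apply, smul_eq_mul]
    linarith
  obtain ⟨c, hc0, hc⟩ : ∃ c : ℝ, 0 ≤ c ∧ ∀ k ∈ J, 0 ≤ c * w k + v k := by
    refine ⟨∑ k ∈ J.erase j, |v k| / w k,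
      Finset.sum_nonneg fun k hk => div_nonneg (abs_nonneg _) (hwpos k hk).le, fun k hk => ?_⟩
    by_cases hkj : k = j
    · subst hkj; simp [hwj, hvj]
    · have hk' := Finset.mem_erase.mpr ⟨hkj, hk⟩
      have h1 : |v k| / w k ≤ ∑ k ∈ J.erase j, |v k| / w k :=
        Finset.single_le_sum (f := fun k => |v k| / w k)
          (fun k hk => div_nonneg (abs_nonneg _) (hwpos k hk).le) hk'
      have h2 := (div_le_iff₀ (hwpos k hk')).mp h1
      linarith [neg_abs_le (v k)]
  have hwf := hface w hws hwj fun k hk => by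
    by_cases hkj : k = j
    · rw [hkj, hwj]
    · exact (hwpos k (Finset.mem_erase.mpr ⟨hkj, hk⟩)).le
  have hcf := hface (c • w + v) (Submodule.add_mem _ (Submodule.smul_mem _ _ hws) hv)
    (by simp [hwj, hvj]) (by simpa using hc)
  simpa using Submodule.sub_mem _ hcf (Submodule.smul_mem _ c hwf)

/-- Moving from `z` in direction `-a` one leaves the orthant of `J` through a coordinate
hyperplane. -/
theorem exists_sub_smul_nonneg_apply_eq_zero {z a : κ → ℝ} (hz : ∀ k ∈ J, 0 ≤ z k)
    (ha : ∀ k ∈ J, 0 ≤ a k) (hpos : ∃ k ∈ J, 0 < a k) :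
    ∃ t : ℝ, 0 ≤ t ∧ (∀ k ∈ J, 0 ≤ (z - t • a) k) ∧ ∃ k ∈ J, (z - t • a) k = 0 := by
  classical
  obtain ⟨j, hj, hjpos⟩ := hpos
  obtain ⟨l, hl, hmin⟩ := Finset.exists_min_image (J.filter fun k => 0 < a k)
    (fun k => z k / a k) ⟨j, Finset.mem_filter.mpr ⟨hj, hjpos⟩⟩
  obtain ⟨hlJ, hlpos⟩ := Finset.mem_filter.mp hl
  have ht : 0 ≤ z l / a l := div_nonneg (hz l hlJ) hlpos.le
  refine ⟨z l / a l, ht, fun k hk => ?_, l, hlJ, ?_⟩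
  · simp only [Pi.sub_apply, Pi.smul_apply, smul_eq_mul, sub_nonneg]
    rcases (ha k hk).eq_or_lt with h0 | h0
    · rw [← h0, mul_zero]; exact hz k hk
    · exact (le_div_iff₀ h0).mp (hmin k (Finset.mem_filter.mpr ⟨hk, h0⟩))
  · simp [div_mul_cancel₀ _ hlpos.ne']

/-- The step from proper faces to the whole cone. -/
theorem RowConeGenerating.of_filter (hM : ∀ i k, 0 ≤ M i k)
    (hpos : ∃ k ∈ J, ∃ i ∈ I, M i k ≠ 0)
    (hface : ∀ j ∈ J, RowConeGenerating M (I.filter fun i => M i j = 0) J)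
    (hspan : ∀ j ∈ J, ∀ z ∈ Submodule.span ℝ (M '' (I : Set ι)), z j = 0 →
      z ∈ Submodule.span ℝ (M '' (I.filter (fun i => M i j = 0) : Set ι))) :
    RowConeGenerating M I J := by
  classical
  intro z hz hzJ
  obtain ⟨k, hk, i, hi, hik⟩ := hpos
  obtain ⟨t, ht, hw, l, hl, hwl⟩ := exists_sub_smul_nonneg_apply_eq_zero hzJ
    (fun k _ => hM i k) ⟨k, hk, lt_of_le_of_ne (hM i k) hik.symm⟩
  obtain ⟨y, hy, hyw⟩ := hface l hl _ (hspan l hl _ (Submodule.sub_mem _ hz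
    (Submodule.smul_mem _ t (Submodule.subset_span ⟨i, hi, rfl⟩))) hwl) hw
  refine ⟨fun i' => (if M i' l = 0 then y i' else 0) + if i' = i then t else 0,
    fun i' => add_nonneg ?_ ?_, ?_⟩
  · split_ifs
    exacts [hy i', le_rfl]
  · split_ifs
    exacts [ht, le_rfl]
  · rw [sub_eq_iff_eq_add] at hyw
    rw [hyw, Finset.sum_filter]
    simp [add_smul, Finset.sum_add_distrib, ite_smul, hi]

/-- The cone generating property only depends on the zero pattern, as long as the rank does not
increase. -/
theorem RowConeGenerating.of_same_zeros [Finite κ] (hS : ∀ i k, 0 ≤ S i k)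
    (hM : ∀ i k, 0 ≤ M i k) (hSM : ∀ i k, S i k = 0 ↔ M i k = 0)
    (I : Finset ι) (J : Finset κ) (h : RowConeGenerating S I J)
    (hrank : Module.finrank ℝ (Submodule.span ℝ (M '' (I : Set ι))) ≤
      Module.finrank ℝ (Submodule.span ℝ (S '' (I : Set ι)))) :
    RowConeGenerating M I J ∧
      Module.finrank ℝ (Submodule.span ℝ (M '' (I : Set ι))) =
        Module.finrank ℝ (Submodule.span ℝ (S '' (I : Set ι))) := by
  classical
  induction I using Finset.strongInduction generalizing J with
  | H I ih =>
  obtain ⟨J₀, hJ₀, hmin⟩ := exists_minimal_le_of_wellFoundedLT (RowConeGenerating S I) J h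
  suffices H : RowConeGenerating M I J₀ ∧
      Module.finrank ℝ (Submodule.span ℝ (M '' (I : Set ι))) =
        Module.finrank ℝ (Submodule.span ℝ (S '' (I : Set ι))) from
    ⟨fun z hz hzJ => H.1 z hz fun k hk => hzJ k (hJ₀ hk), H.2⟩
  have h₀ := hmin.prop
  rcases J₀.eq_empty_or_nonempty with rfl | ⟨j₀, hj₀⟩
  · have hbot : Submodule.span ℝ (S '' (I : Set ι)) = ⊥ := by
      have hnn : ∀ z ∈ Submodule.span ℝ (S '' (I : Set ι)), ∀ k, 0 ≤ z k := by
        intro z hz k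
        obtain ⟨y, hy, rfl⟩ := h₀ z hz (by simp)
        simpa using Finset.sum_nonneg fun i (_ : i ∈ I) => mul_nonneg (hy i) (hS i k)
      rw [Submodule.eq_bot_iff]
      intro z hz
      ext k
      exact le_antisymm (by simpa using hnn (-z) (Submodule.neg_mem _ hz) k) (hnn z hz k)
    rw [hbot, finrank_bot] at hrank ⊢
    have h0 := Nat.le_zero.mp hrank
    refine ⟨fun z hz _ => ⟨0, le_rfl, ?_⟩, h0⟩
    rw [Submodule.finrank_eq_zero.mp h0] at hz
    simpa using hz
  · have hx : ∀ j ∈ J₀, ∃ x ∈ Submodule.span ℝ (S '' (I : Set ι)),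
        (∀ k ∈ J₀.erase j, 0 ≤ x k) ∧ x j < 0 := by
      intro j hj
      have hnot := hmin.not_prop_of_lt (Finset.erase_ssubset hj)
      simp only [RowConeGenerating, not_forall] at hnot
      obtain ⟨x, hx, hxk, hxn⟩ := hnot
      refine ⟨x, hx, hxk, lt_of_not_ge fun hxj => hxn (h₀ x hx fun k hk => ?_)⟩
      by_cases hkj : k = j
      · exact hkj ▸ hxj
      · exact hxk k (Finset.mem_erase.mpr ⟨hkj, hk⟩)
    have hcol : ∀ j ∈ J₀, ∃ i ∈ I, S i j ≠ 0 := by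
      intro j hj
      by_contra! hcon
      obtain ⟨x, hx, -, hxj⟩ := hx j hj
      rw [← Finset.filter_true_of_mem hcon] at hx
      exact hxj.ne (mem_span_image_filter_apply_eq_zero hx)
    have hfilter : ∀ j, (I.filter fun i => M i j = 0) = I.filter fun i => S i j = 0 := fun j =>
      Finset.filter_congr fun i _ => (hSM i j).symm
    have key : ∀ j ∈ J₀, RowConeGenerating M (I.filter fun i => M i j = 0) J₀ ∧
        (∀ z ∈ Submodule.span ℝ (M '' (I : Set ι)), z j = 0 →
          z ∈ Submodule.span ℝ (M '' (I.filter (fun i => M i j = 0) : Set ι))) ∧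
        Module.finrank ℝ (Submodule.span ℝ (M '' (I : Set ι))) =
          Module.finrank ℝ (Submodule.span ℝ (S '' (I : Set ι))) := by
      intro j hj
      obtain ⟨x, hxs, hxk, hxj⟩ := hx j hj
      obtain ⟨i, hi, hij⟩ := hcol j hj
      set π : (κ → ℝ) →ₗ[ℝ] ℝ := LinearMap.proj j with hπ
      have hss : (I.filter fun i => S i j = 0) ⊂ I :=
        Finset.filter_ssubset.mpr ⟨i, hi, hij⟩
      have hSface : Module.finrank ℝ (Submodule.span ℝ (S '' (I : Set ι))) ≤
          Module.finrank ℝ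
            (Submodule.span ℝ (S '' (I.filter (fun i => S i j = 0) : Set ι))) + 1 := by
        set L := Submodule.span ℝ (S '' (I : Set ι))
        have h1 := LinearMap.finrank_range_add_finrank_ker (π.domRestrict L)
        have h2 : Module.finrank ℝ (LinearMap.range (π.domRestrict L)) ≤ 1 := by
          simpa using Submodule.finrank_le (LinearMap.range (π.domRestrict L))
        have h3 : Module.finrank ℝ (LinearMap.ker (π.domRestrict L)) ≤ Module.finrank ℝ
            (Submodule.span ℝ (S '' (I.filter (fun i => S i j = 0) : Set ι))) := by
          rw [← Submodule.finrank_map_subtype_eq]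
          refine Submodule.finrank_mono ?_
          rintro _ ⟨v, hv, rfl⟩
          exact h₀.mem_span_filter hS hcol hxs hxk hxj v.2 (by simpa [hπ] using hv)
        omega
      have hlt : Submodule.span ℝ (M '' (I : Set ι)) ⊓ LinearMap.ker π <
          Submodule.span ℝ (M '' (I : Set ι)) := by
        refine lt_of_le_of_ne inf_le_left fun heq => ?_
        have := inf_eq_left.mp heq (Submodule.subset_span (Set.mem_image_of_mem M hi))
        exact hij ((hSM i j).mpr (by simpa [hπ] using this))
      have hlt' := Submodule.finrank_lt_finrank_of_lt hlt
      have hle : Submodule.span ℝ (M '' (I.filter (fun i => M i j = 0) : Set ι)) ≤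
          Submodule.span ℝ (M '' (I : Set ι)) ⊓ LinearMap.ker π :=
        le_inf (Submodule.span_mono
          (Set.image_mono (Finset.coe_subset.mpr (Finset.filter_subset _ _))))
          fun z hz => by simpa [hπ] using mem_span_image_filter_apply_eq_zero hz
      have hle' := Submodule.finrank_mono hle
      have hIH := ih _ hss J₀ (h₀.filter hS j) (by rw [← hfilter] at *; omega)
      rw [← hfilter] at hIH hSface
      refine ⟨hIH.1, fun z hz hzj => ?_, by omega⟩
      rw [Submodule.eq_of_le_of_finrank_le hle (by omega)]
      exact ⟨hz, by simpa [hπ] using hzj⟩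
    refine ⟨.of_filter hM ?_ (fun j hj => (key j hj).1) fun j hj => (key j hj).2.1,
      (key j₀ hj₀).2.2⟩
    obtain ⟨i, hi, hij⟩ := hcol j₀ hj₀
    exact ⟨j₀, hj₀, i, hi, fun h => hij ((hSM i j₀).mpr h)⟩

end RowConeGenerating

theorem vecMul_eq_sum_smul_row {p q : ℕ} (y : Fin p → ℝ) (M : Matrix (Fin p) (Fin q) ℝ) :
    y ᵥ* M = ∑ i, y i • M.row i :=
  Matrix.vecMul_eq_sum y M

theorem row_mem_coneOfRows {p n : ℕ} (A : Matrix (Fin p) (Fin n) ℝ) (i : Fin p) :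
    A.row i ∈ coneOfRows A :=
  ⟨Pi.single i 1, by simp, by simp [Matrix.row]⟩

theorem mem_span_image_univ_iff_exists_vecMul {p q : ℕ} (M : Matrix (Fin p) (Fin q) ℝ)
    (z : Fin q → ℝ) :
    z ∈ Submodule.span ℝ (M.row '' ((Finset.univ : Finset (Fin p)) : Set (Fin p))) ↔
      ∃ y : Fin p → ℝ, y ᵥ* M = z := by
  rw [Finset.coe_univ, Set.image_univ, Submodule.mem_span_range_iff_exists_fun]
  simp only [vecMul_eq_sum_smul_row]

theorem rank_eq_finrank_span_image_univ {p q : ℕ} (M : Matrix (Fin p) (Fin q) ℝ) :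
    M.rank = Module.finrank ℝ
      (Submodule.span ℝ (M.row '' ((Finset.univ : Finset (Fin p)) : Set (Fin p)))) := by
  rw [Matrix.rank_eq_finrank_span_row, Finset.coe_univ, Set.image_univ]

/-- Slack matrices of cones satisfy the row cone generating condition. -/
theorem rowConeGenerating_of_slack {p q n : ℕ} {A : Matrix (Fin p) (Fin n) ℝ}
    {B : Matrix (Fin n) (Fin q) ℝ} (h : {x : Fin n → ℝ | 0 ≤ x ᵥ* B} = coneOfRows A) :
    RowConeGenerating (A * B).row Finset.univ Finset.univ := by
  intro z hz hz0
  obtain ⟨y, rfl⟩ := (mem_span_image_univ_iff_exists_vecMul _ _).mp hz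
  have hmem : y ᵥ* A ∈ {x : Fin n → ℝ | 0 ≤ x ᵥ* B} := by
    rw [Set.mem_ofPred_eq, Matrix.vecMul_vecMul]
    exact fun k => hz0 k (Finset.mem_univ k)
  rw [h] at hmem
  obtain ⟨y', hy', heq⟩ := hmem
  refine ⟨y', hy', ?_⟩
  rw [← Matrix.vecMul_vecMul, heq, Matrix.vecMul_vecMul, vecMul_eq_sum_smul_row]

/-- A nonnegative matrix satisfying the row cone generating condition is a slack matrix of a
pointed cone of dimension its rank. -/
theorem RowConeGenerating.exists_pointed_cone {p q : ℕ} {M : Matrix (Fin p) (Fin q) ℝ}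
    (hM : ∀ i j, 0 ≤ M i j) (h : RowConeGenerating M.row Finset.univ Finset.univ) :
    ∃ (n : ℕ) (K : Set (Fin n → ℝ)) (A : Matrix (Fin p) (Fin n) ℝ)
      (B : Matrix (Fin n) (Fin q) ℝ),
      IsSlackMatrixOfConeRep M K A B ∧ IsPointedCone K ∧ coneDim K = M.rank := by
  set L := Submodule.span ℝ (M.row '' ((Finset.univ : Finset (Fin p)) : Set (Fin p)))
  have hrank : M.rank = Module.finrank ℝ L := rank_eq_finrank_span_image_univ M
  let b := Module.finBasis ℝ L
  have hrow : ∀ i, M.row i ∈ L := fun i => Submodule.subset_span ⟨i, by simp, rfl⟩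
  let A : Matrix (Fin p) (Fin (Module.finrank ℝ L)) ℝ :=
    Matrix.of fun i => b.equivFun ⟨M.row i, hrow i⟩
  let B : Matrix (Fin (Module.finrank ℝ L)) (Fin q) ℝ := Matrix.of fun k => (b k : Fin q → ℝ)
  have hB : ∀ x, x ᵥ* B = (b.equivFun.symm x : Fin q → ℝ) := by
    intro x
    rw [vecMul_eq_sum_smul_row, Module.Basis.equivFun_symm_apply, Submodule.coe_sum]
    rfl
  have hAB : M = A * B := by
    ext i j
    have hrowB : A.row i ᵥ* B = M.row i := by
      rw [hB, show A.row i = b.equivFun ⟨M.row i, hrow i⟩ from rfl, LinearEquiv.symm_apply_apply]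
    exact (congrFun hrowB j).symm
  have hBinj : ∀ x, x ᵥ* B = 0 → x = 0 := by
    intro x hx
    rwa [hB, Submodule.coe_eq_zero, LinearEquiv.map_eq_zero_iff] at hx
  have hK : {x | 0 ≤ x ᵥ* B} = coneOfRows A := by
    ext x
    constructor
    · intro hx
      obtain ⟨y, hy, hyx⟩ := h (x ᵥ* B) (hB x ▸ (b.equivFun.symm x).2) fun k _ => hx k
      refine ⟨y, hy, sub_eq_zero.mp (hBinj _ ?_)⟩
      rw [Matrix.sub_vecMul, Matrix.vecMul_vecMul, ← hAB, hyx, vecMul_eq_sum_smul_row, sub_self]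
    · rintro ⟨y, hy, rfl⟩
      rw [Set.mem_ofPred_eq, Matrix.vecMul_vecMul, ← hAB]
      exact fun j => show 0 ≤ ∑ i, y i * M i j from Finset.sum_nonneg fun i _ => mul_nonneg (hy i) (hM i j)
  refine ⟨_, _, A, B, ⟨rfl, hK, hAB⟩, fun x hx hx' => hBinj x ?_, le_antisymm ?_ ?_⟩
  · rw [Set.mem_ofPred_eq, Matrix.neg_vecMul] at hx'
    exact le_antisymm (neg_nonneg.mp hx') hx
  · rw [hrank]
    exact (Submodule.finrank_le _).trans (by simp)
  · calc M.rank ≤ A.rank := hAB ▸ Matrix.rank_mul_le_left A B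
      _ ≤ coneDim {x | 0 ≤ x ᵥ* B} := by
        rw [Matrix.rank_eq_finrank_span_row, coneDim, hK]
        refine Submodule.finrank_mono (Submodule.span_mono ?_)
        rintro _ ⟨i, rfl⟩
        exact row_mem_coneOfRows A i

/-- A slack matrix of a pointed cone has rank equal to the dimension of the cone. -/
theorem IsSlackMatrixOfConeRep.rank_eq {p q n : ℕ} {S : Matrix (Fin p) (Fin q) ℝ}
    {K : Set (Fin n → ℝ)} {A : Matrix (Fin p) (Fin n) ℝ} {B : Matrix (Fin n) (Fin q) ℝ}
    (h : IsSlackMatrixOfConeRep S K A B) (hK : IsPointedCone K) : S.rank = coneDim K := by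
  obtain ⟨h1, h2, rfl⟩ := h
  have hinj : Function.Injective B.vecMulLinear := by
    rw [injective_iff_map_eq_zero]
    intro x hx
    rw [Matrix.vecMulLinear_apply] at hx
    exact hK x (by simp [h1, hx]) (by simp [h1, Matrix.neg_vecMul, hx])
  have hspan : Submodule.span ℝ K =
      Submodule.span ℝ (A.row '' ((Finset.univ : Finset (Fin p)) : Set (Fin p))) := by
    refine le_antisymm (Submodule.span_le.mpr ?_) (Submodule.span_mono ?_)
    · rw [h2]
      rintro _ ⟨y, -, rfl⟩
      exact (mem_span_image_univ_iff_exists_vecMul _ _).mpr ⟨y, rfl⟩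
    · rintro _ ⟨i, -, rfl⟩
      rw [h2]
      exact row_mem_coneOfRows A i
  rw [rank_eq_finrank_span_image_univ, coneDim, hspan,
    (Submodule.equivMapOfInjective B.vecMulLinear hinj _).finrank_eq, Submodule.map_span,
    Set.image_image]
  rfl

theorem inc_eq_inc_iff {p q : ℕ} {S M : Matrix (Fin p) (Fin q) ℝ} :
    inc S = inc M ↔ ∀ i j, S i j = 0 ↔ M i j = 0 := by
  refine ⟨fun h i j => ?_, fun h => by ext i j; simp [inc, h]⟩
  have := congrFun (congrFun h i) j
  simp only [inc, Matrix.of_apply] at this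
  split_ifs at this <;> simp_all

/-- **Theorem (combinatorial characterization for cones).**
A nonnegative matrix `M` with `rank M ≥ 2` is a slack matrix of a polyhedral
cone if and only if `inc M` is an incidence matrix of some pointed polyhedral
cone of dimension `rank M`. -/
theorem slack_matrix_of_cone_iff_incidence {p q : ℕ}
    (M : Matrix (Fin p) (Fin q) ℝ) (hM : ∀ i j, 0 ≤ M i j) (hrank : 2 ≤ M.rank) :
    IsSlackMatrixOfCone M ↔
      ∃ (n : ℕ) (K : Set (Fin n → ℝ)) (A : Matrix (Fin p) (Fin n) ℝ)
        (B : Matrix (Fin n) (Fin q) ℝ) (S : Matrix (Fin p) (Fin q) ℝ),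
        IsSlackMatrixOfConeRep S K A B ∧ IsPointedCone K ∧
          coneDim K = M.rank ∧ inc S = inc M := by
  constructor
  · rintro ⟨n, A, B, hAB, rfl⟩
    obtain ⟨m, K, A', B', hrep, hK, hdim⟩ :=
      (rowConeGenerating_of_slack hAB).exists_pointed_cone hM
    exact ⟨m, K, A', B', _, hrep, hK, hdim, rfl⟩
  · rintro ⟨n, K, A, B, S, hrep, hK, hdim, hinc⟩
    have hSrank := hrep.rank_eq hK
    obtain ⟨h1, h2, rfl⟩ := hrep
    have hS : ∀ i j, 0 ≤ (A * B) i j := by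
      intro i
      have hmem : A i ∈ K := by
        rw [h2]
        exact row_mem_coneOfRows A i
      rw [h1] at hmem
      exact hmem
    have hgen := (RowConeGenerating.of_same_zeros (S := (A * B).row) (M := M.row) hS hM (inc_eq_inc_iff.mp hinc) _ _
      (rowConeGenerating_of_slack (h1.symm.trans h2)) (by
        have := rank_eq_finrank_span_image_univ M
        have := rank_eq_finrank_span_image_univ (A * B)
        omega)).1
    obtain ⟨m, K', A', B', ⟨h1', h2', h3'⟩, -, -⟩ := hgen.exists_pointed_cone hM
    exact ⟨m, A', B', h1'.symm.trans h2', h3'⟩
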